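/- Let D be an ω-continuous semiring and let f(X) be a univariate polynomial expression over D (an expression built from semiring constants, the variable X, ⊕, and ⊗), with NPA differential D f|_ν(Y) defined by: D f|_ν(Y) = 0 if f is a constant; Y if f = X; D g|_ν(Y) ⊕ D h|_ν(Y) if f = g ⊕ h; and (D g|_ν(Y) ⊗ h(ν)) ⊕ (g(ν) ⊗ D h|_ν(Y)) if f = g ⊗ h. Then for all ν, Δ ∈ D: f(ν) ⊕ D f|_ν(Δ) ⊑ f(ν ⊕ Δ), i.e., the linearization of f at ν is an under-approximation with respect to the induced order. -/

import Mathlib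

/-- The order induced by a `combine` operation: `a ⊑ b ↔ ∃ d, a ⊕ d = b`. -/
def srle {D : Type} (add : D → D → D) (a b : D) : Prop := ∃ d, add a d = b

/-- `s` is the supremum of the ω-chain `c` with respect to the relation `le`. -/
def IsChainSup {D : Type} (le : D → D → Prop) (c : ℕ → D) (s : D) : Prop :=
  (∀ i, le (c i) s) ∧ ∀ u, (∀ i, le (c i) u) → le s u

/-- `f` is ω-continuous w.r.t. `le`: monotone and preserving suprema of ω-chains. -/
def IsOmegaCont {D : Type} (le : D → D → Prop) (f : D → D) : Prop :=
  (∀ a b, le a b → le (f a) (f b)) ∧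
  ∀ (c : ℕ → D) (s : D), (∀ i, le (c i) (c (i + 1))) → IsChainSup le c s →
    IsChainSup le (fun i => f (c i)) (f s)

/-- An ω-continuous semiring `⟨D, ⊕, ⊗, 0, 1⟩`: the induced relation
`a ⊑ b ↔ ∃ d, a ⊕ d = b` is a partial order, every ω-chain has a supremum,
and `⊕`, `⊗` are ω-continuous in both arguments. -/
structure OmegaCSRing (D : Type) where
  add : D → D → D
  mul : D → D → D
  zero : D
  one : D
  add_assoc : ∀ a b c, add (add a b) c = add a (add b c)
  add_comm : ∀ a b, add a b = add b a
  add_zero : ∀ a, add a zero = a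
  mul_assoc : ∀ a b c, mul (mul a b) c = mul a (mul b c)
  one_mul : ∀ a, mul one a = a
  mul_one : ∀ a, mul a one = a
  left_distrib : ∀ a b c, mul a (add b c) = add (mul a b) (mul a c)
  right_distrib : ∀ a b c, mul (add a b) c = add (mul a c) (mul b c)
  le_antisymm : ∀ a b, srle add a b → srle add b a → a = b
  chain_sup : ∀ c : ℕ → D, (∀ i, srle add (c i) (c (i + 1))) →
    ∃ s, IsChainSup (srle add) c s
  add_cont_left : ∀ a, IsOmegaCont (srle add) fun x => add x a
  add_cont_right : ∀ a, IsOmegaCont (srle add) (add a)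
  mul_cont_left : ∀ a, IsOmegaCont (srle add) fun x => mul x a
  mul_cont_right : ∀ a, IsOmegaCont (srle add) (mul a)

/-- Univariate polynomial expressions over `D`: constants, the variable `X`,
`⊕`, and `⊗`. -/
inductive PolyExp (D : Type) where
  | const (a : D)
  | X
  | add (f g : PolyExp D)
  | mul (f g : PolyExp D)

/-- Evaluation `f(ν)` of a polynomial expression. -/
def PolyExp.eval {D : Type} (S : OmegaCSRing D) : PolyExp D → D → D
  | .const a, _ => a
  | .X, v => v
  | .add f g, v => S.add (PolyExp.eval S f v) (PolyExp.eval S g v)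
  | .mul f g, v => S.mul (PolyExp.eval S f v) (PolyExp.eval S g v)

/-- The NPA differential `D f|_ν(Y)` evaluated at `Y = Δ`. -/
def PolyExp.diff {D : Type} (S : OmegaCSRing D) : PolyExp D → D → D → D
  | .const _, _, _ => S.zero
  | .X, _, d => d
  | .add f g, v, d => S.add (PolyExp.diff S f v d) (PolyExp.diff S g v d)
  | .mul f g, v, d =>
      S.add (S.mul (PolyExp.diff S f v d) (PolyExp.eval S g v))
            (S.mul (PolyExp.eval S f v) (PolyExp.diff S g v d))

/-- The linearization of `f` at `ν` under-approximates: for all `ν, Δ ∈ D`,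
`f(ν) ⊕ D f|_ν(Δ) ⊑ f(ν ⊕ Δ)`. -/
theorem linearization_under_approx {D : Type} (S : OmegaCSRing D)
    (f : PolyExp D) (ν Δ : D) :
    srle S.add (S.add (PolyExp.eval S f ν) (PolyExp.diff S f ν Δ))
      (PolyExp.eval S f (S.add ν Δ)) := by
  have : Std.Associative S.add := ⟨S.add_assoc⟩
  have : Std.Commutative S.add := ⟨S.add_comm⟩
  induction f with
  | const a => exact ⟨S.zero, by simp only [PolyExp.eval, PolyExp.diff, S.add_zero]⟩
  | X => exact ⟨S.zero, S.add_zero _⟩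
  | add f g ihf ihg =>
    obtain ⟨r, hr⟩ := ihf
    obtain ⟨s, hs⟩ := ihg
    refine ⟨S.add r s, ?_⟩
    simp only [PolyExp.eval, PolyExp.diff, ← hr, ← hs]
    ac_rfl
  | mul f g ihf ihg =>
    obtain ⟨r, hr⟩ := ihf
    obtain ⟨s, hs⟩ := ihg
    refine ⟨S.add (S.mul (f.diff S ν Δ) (g.diff S ν Δ))
      (S.add (S.mul (S.add (f.eval S ν) (f.diff S ν Δ)) s)
        (S.mul r (g.eval S (S.add ν Δ)))), ?_⟩
    simp only [PolyExp.eval, PolyExp.diff, ← hr, ← hs, S.left_distrib, S.right_distrib]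
    ac_rfl
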